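/- arXiv:2303.16988 — 8 statements merged into one kernel-verified Lean document; each statement's English description precedes it below -/
import Mathlib

section
/- Let η > 0 and x ∈ R. The function λ ↦ x^2/(2λ) + λ − η·log λ on the interval (0,∞) attains its global minimum at the unique point λ* = (1/2)·(η + sqrt(η^2 + 2·x^2)), i.e., λ* minimizes the function on (0,∞) and any other minimizer equals λ*. -/
/-- If `L` is a critical point of `t ↦ c / t + t - η * log t` on `(0, ∞)` (so that
`c = L * (L - η)`) and `η ≤ L`, then `L` is its strict global minimizer there. -/
theorem div_add_sub_mul_log_lt_of_ne {η L t : ℝ} (hη : 0 < η) (hL : η ≤ L) (ht : 0 < t)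
    (hne : t ≠ L) :
    L * (L - η) / L + L - η * Real.log L < L * (L - η) / t + t - η * Real.log t := by
  have hL0 : 0 < L := hη.trans_le hL
  have hlog : Real.log t - Real.log L < t / L - 1 := by
    rw [← Real.log_div ht.ne' hL0.ne']
    exact Real.log_lt_sub_one_of_pos (div_pos ht hL0) (by rwa [Ne, div_eq_one_iff_eq hL0.ne'])
  have hsq : 0 ≤ (L - η) * (t - L) ^ 2 / (t * L) := by
    have := sub_nonneg.2 hL
    positivity
  have key : L * (L - η) / t + t - (L * (L - η) / L + L) - η * (t / L - 1)
      = (L - η) * (t - L) ^ 2 / (t * L) := by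
    field_simp
    ring
  linarith [mul_lt_mul_of_pos_left hlog hη]


/-- The λ-update of the IAS algorithm for the gamma hyperprior (`r = 1`, `η = β - 3/2 > 0`):
the function `λ ↦ x²/(2λ) + λ - η·log λ` on `(0, ∞)` attains its global minimum at the unique
point `λ* = (η + √(η² + 2x²))/2`. -/
theorem ias_gamma_lambda_update (η : ℝ) (hη : 0 < η) (x : ℝ) :
    0 < (η + Real.sqrt (η ^ 2 + 2 * x ^ 2)) / 2 ∧
    (∀ lam : ℝ, 0 < lam →
      x ^ 2 / (2 * ((η + Real.sqrt (η ^ 2 + 2 * x ^ 2)) / 2))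
          + (η + Real.sqrt (η ^ 2 + 2 * x ^ 2)) / 2
          - η * Real.log ((η + Real.sqrt (η ^ 2 + 2 * x ^ 2)) / 2)
        ≤ x ^ 2 / (2 * lam) + lam - η * Real.log lam) ∧
    (∀ lam : ℝ, 0 < lam →
      (∀ lam' : ℝ, 0 < lam' →
        x ^ 2 / (2 * lam) + lam - η * Real.log lam
          ≤ x ^ 2 / (2 * lam') + lam' - η * Real.log lam') →
      lam = (η + Real.sqrt (η ^ 2 + 2 * x ^ 2)) / 2) := by
  set L := (η + Real.sqrt (η ^ 2 + 2 * x ^ 2)) / 2 with hLdef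
  have hsqrt : Real.sqrt (η ^ 2 + 2 * x ^ 2) ^ 2 = η ^ 2 + 2 * x ^ 2 :=
    Real.sq_sqrt (by positivity)
  have hL : η ≤ L := by
    have : η ≤ Real.sqrt (η ^ 2 + 2 * x ^ 2) :=
      Real.le_sqrt_of_sq_le (by linarith [sq_nonneg x])
    linarith
  have hcrit : x ^ 2 / 2 = L * (L - η) := by
    rw [hLdef]
    linarith
  have hL0 : 0 < L := hη.trans_le hL
  have hlt : ∀ t : ℝ, 0 < t → t ≠ L →
      x ^ 2 / (2 * L) + L - η * Real.log L < x ^ 2 / (2 * t) + t - η * Real.log t := by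
    intro t ht hne
    rw [← div_div, ← div_div, hcrit]
    exact div_add_sub_mul_log_lt_of_ne hη hL ht hne
  refine ⟨hL0, fun t ht => ?_, fun t ht hmin => ?_⟩
  · rcases eq_or_ne t L with h | h
    · rw [h]
    · exact (hlt t ht h).le
  · by_contra h
    exact (hlt t ht h).not_ge (hmin L hL0)
end

section
/- For every η > 0, the function (x, λ) ↦ x^2/(2λ) + λ − η·log λ is strictly convex on the convex set R × (0,∞) ⊂ R^2. -/
theorem sq_div_perspective_gap {a b x u l m : ℝ} (hl : l ≠ 0) (hm : m ≠ 0)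
    (hs : a * l + b * m ≠ 0) :
    a * (x ^ 2 / (2 * l)) + b * (u ^ 2 / (2 * m)) - (a * x + b * u) ^ 2 / (2 * (a * l + b * m)) =
      a * b * (x * m - u * l) ^ 2 / (2 * (l * m * (a * l + b * m))) := by
  field_simp
  ring

/-- For every `η > 0`, the function `(x, λ) ↦ x²/(2λ) + λ - η·log λ` is strictly convex on
the convex set `ℝ × (0, ∞) ⊆ ℝ²`. -/
theorem strictConvexOn_gibbs_summand (η : ℝ) (hη : 0 < η) :
    StrictConvexOn ℝ ((Set.univ : Set ℝ) ×ˢ Set.Ioi (0 : ℝ))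
      (fun p : ℝ × ℝ => p.1 ^ 2 / (2 * p.2) + p.2 - η * Real.log p.2) := by
  refine ⟨convex_univ.prod (convex_Ioi 0), ?_⟩
  rintro ⟨x, l⟩ ⟨-, hl⟩ ⟨u, m⟩ ⟨-, hm⟩ hne a b ha hb hab
  simp only [Set.mem_Ioi] at hl hm
  simp only [Prod.smul_mk, Prod.mk_add_mk, smul_eq_mul]
  have hs : 0 < a * l + b * m := by positivity
  have hgap := sq_div_perspective_gap (a := a) (b := b) (x := x) (u := u) hl.ne' hm.ne' hs.ne'
  rcases eq_or_ne l m with rfl | hlm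
  · have hxu : x - u ≠ 0 := sub_ne_zero.2 fun h => hne (by rw [h])
    have hpos : 0 < a * b * (x * l - u * l) ^ 2 / (2 * (l * l * (a * l + b * l))) := by
      rw [← sub_mul]
      positivity
    have hsum : a * l + b * l = l := by rw [← add_mul, hab, one_mul]
    have hlog : η * Real.log (a * l + b * l) = a * (η * Real.log l) + b * (η * Real.log l) := by
      rw [hsum, ← add_mul, hab, one_mul]
    linarith
  · have hnonneg : 0 ≤ a * b * (x * m - u * l) ^ 2 / (2 * (l * m * (a * l + b * m))) := by
      positivity
    have hlog := mul_lt_mul_of_pos_left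
      (strictConcaveOn_log_Ioi.2 hl hm hlm ha hb hab) hη
    simp only [smul_eq_mul] at hlog
    linarith
end

section
/- Let A ∈ R^{m×n}, b ∈ R^m, and η > 0. The Gibbs energy functional E(ξ, λ) = (1/2)‖b − Aξ‖^2 + sum_{j=1}^n ( ξ_j^2/(2λ_j) + λ_j − η·log λ_j ), defined for ξ ∈ R^n and λ ∈ (0,∞)^n, has a unique global minimizer (ξ*, λ*) on R^n × (0,∞)^n. -/
open scoped Matrix

/-- The Gibbs energy functional of the gamma hypermodel (`r = 1`, `η = β - 3/2 > 0`) with a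
linear forward model `A`:
`E(ξ, λ) = (1/2)‖b - Aξ‖² + ∑ⱼ ( ξⱼ²/(2λⱼ) + λⱼ - η·log λⱼ )`. -/
noncomputable def gibbsEnergy {m n : ℕ} (A : Matrix (Fin m) (Fin n) ℝ) (b : Fin m → ℝ)
    (η : ℝ) (ξ lam : Fin n → ℝ) : ℝ :=
  (1 / 2) * ∑ i, (b i - (A *ᵥ ξ) i) ^ 2
    + ∑ j, ((ξ j) ^ 2 / (2 * lam j) + lam j - η * Real.log (lam j))

/-- The contribution of one coordinate pair to the prior part of the Gibbs energy. -/
noncomputable def gibbsTerm (η x l : ℝ) : ℝ :=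
  x ^ 2 / (2 * l) + l - η * Real.log l

lemma gibbsEnergy_eq {m n : ℕ} (A : Matrix (Fin m) (Fin n) ℝ) (b : Fin m → ℝ)
    (η : ℝ) (ξ lam : Fin n → ℝ) :
    gibbsEnergy A b η ξ lam =
      (1 / 2) * ∑ i, (b i - (A *ᵥ ξ) i) ^ 2 + ∑ j, gibbsTerm η (ξ j) (lam j) :=
  rfl

lemma le_sub_mul_log {η l : ℝ} (hη : 0 < η) (hl : 0 < l) :
    η - η * Real.log η ≤ l - η * Real.log l := by
  have h := Real.log_le_sub_one_of_pos (div_pos hl hη)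
  rw [Real.log_div hl.ne' hη.ne'] at h
  have h2 := mul_le_mul_of_nonneg_left h hη.le
  have h3 : η * (l / η - 1) = l - η := by field_simp
  linarith

lemma le_gibbsTerm {η l : ℝ} (x : ℝ) (hη : 0 < η) (hl : 0 < l) :
    η - η * Real.log η ≤ gibbsTerm η x l := by
  have h := le_sub_mul_log hη hl
  have h2 : 0 ≤ x ^ 2 / (2 * l) := by positivity
  unfold gibbsTerm
  linarith

/-- Sublevel sets of a single term are contained in a box bounded away from `l = 0`. -/
lemma exists_bounds_of_gibbsTerm_le {η : ℝ} (hη : 0 < η) (M : ℝ) :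
    ∃ R a L : ℝ, 0 < a ∧ ∀ x l, 0 < l → gibbsTerm η x l ≤ M →
      x ∈ Set.Icc (-R) R ∧ l ∈ Set.Icc a L := by
  set c := η - η * Real.log η
  set L := 2 * (M - (η - η * Real.log (2 * η)))
  refine ⟨Real.sqrt (2 * L * (M - c)), Real.exp (-M / η), L, Real.exp_pos _, ?_⟩
  intro x l hl h
  have hx : 0 ≤ x ^ 2 / (2 * l) := by positivity
  have hc := le_sub_mul_log hη hl
  have hlL : l ≤ L := by
    have h1 := le_sub_mul_log (η := 2 * η) (by positivity) hl
    unfold gibbsTerm at h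
    simp only [L]
    linarith
  unfold gibbsTerm at h
  refine ⟨?_, ?_, hlL⟩
  · refine abs_le.mp (Real.abs_le_sqrt ?_)
    have h1 : x ^ 2 / (2 * l) ≤ M - c := by simp only [c]; linarith
    rw [div_le_iff₀ (by positivity)] at h1
    have h2 : 0 ≤ M - c := by simp only [c]; linarith
    nlinarith [mul_le_mul_of_nonneg_left hlL h2]
  · rw [← Real.le_log_iff_exp_le hl, div_le_iff₀ hη]
    linarith

lemma sq_div_midpoint_le {l k : ℝ} (x y : ℝ) (hl : 0 < l) (hk : 0 < k) :
    ((x + y) / 2) ^ 2 / (2 * ((l + k) / 2)) ≤ (x ^ 2 / (2 * l) + y ^ 2 / (2 * k)) / 2 := by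
  have h : (x ^ 2 / (2 * l) + y ^ 2 / (2 * k)) / 2 - ((x + y) / 2) ^ 2 / (2 * ((l + k) / 2))
      = (x * k - y * l) ^ 2 / (4 * l * k * (l + k)) := by
    field_simp
    ring
  have h2 : 0 ≤ (x * k - y * l) ^ 2 / (4 * l * k * (l + k)) := by positivity
  linarith

lemma gibbsTerm_midpoint_lt {η x y l k : ℝ} (hη : 0 < η) (hl : 0 < l) (hk : 0 < k)
    (hne : x ≠ y ∨ l ≠ k) :
    gibbsTerm η ((x + y) / 2) ((l + k) / 2) < (gibbsTerm η x l + gibbsTerm η y k) / 2 := by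
  unfold gibbsTerm
  by_cases hlk : l = k
  · subst hlk
    have hxy : x - y ≠ 0 := sub_ne_zero.mpr (hne.resolve_right (by simp))
    have h : (x ^ 2 / (2 * l) + y ^ 2 / (2 * l)) / 2 - ((x + y) / 2) ^ 2 / (2 * l)
        = (x - y) ^ 2 / (8 * l) := by
      field_simp
      ring
    have h2 : 0 < (x - y) ^ 2 / (8 * l) := by positivity
    rw [add_self_div_two]
    linarith
  · have h1 := sq_div_midpoint_le x y hl hk
    have h2 := strictConcaveOn_log_Ioi.2 (Set.mem_Ioi.mpr hl) (Set.mem_Ioi.mpr hk) hlk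
      (by norm_num : (0 : ℝ) < 1 / 2) (by norm_num : (0 : ℝ) < 1 / 2) (by norm_num)
    simp only [smul_eq_mul] at h2
    rw [show 1 / 2 * l + 1 / 2 * k = (l + k) / 2 by ring] at h2
    have h3 := mul_lt_mul_of_pos_left h2 hη
    linarith

lemma gibbsTerm_midpoint_le {η l k : ℝ} (x y : ℝ) (hη : 0 < η) (hl : 0 < l) (hk : 0 < k) :
    gibbsTerm η ((x + y) / 2) ((l + k) / 2) ≤ (gibbsTerm η x l + gibbsTerm η y k) / 2 := by
  by_cases hne : x ≠ y ∨ l ≠ k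
  · exact (gibbsTerm_midpoint_lt hη hl hk hne).le
  · push Not at hne
    obtain ⟨rfl, rfl⟩ := hne
    simp

lemma gibbsEnergy_midpoint_lt {m n : ℕ} (A : Matrix (Fin m) (Fin n) ℝ) (b : Fin m → ℝ)
    {η : ℝ} (hη : 0 < η) {p q : (Fin n → ℝ) × (Fin n → ℝ)}
    (hp : ∀ j, 0 < p.2 j) (hq : ∀ j, 0 < q.2 j) (hne : p ≠ q) :
    gibbsEnergy A b η (fun j => (p.1 j + q.1 j) / 2) (fun j => (p.2 j + q.2 j) / 2) <
      (gibbsEnergy A b η p.1 p.2 + gibbsEnergy A b η q.1 q.2) / 2 := by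
  have hdata : ∑ i, (b i - (A *ᵥ fun j => (p.1 j + q.1 j) / 2) i) ^ 2 ≤
      (∑ i, (b i - (A *ᵥ p.1) i) ^ 2 + ∑ i, (b i - (A *ᵥ q.1) i) ^ 2) / 2 := by
    rw [← Finset.sum_add_distrib, Finset.sum_div]
    refine Finset.sum_le_sum fun i _ => ?_
    have hmid : (fun j => (p.1 j + q.1 j) / 2) = (1 / 2 : ℝ) • (p.1 + q.1) := by
      ext j
      simp only [Pi.smul_apply, Pi.add_apply, smul_eq_mul]
      ring
    rw [hmid, Matrix.mulVec_smul, Matrix.mulVec_add]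
    simp only [Pi.smul_apply, Pi.add_apply, smul_eq_mul]
    nlinarith [sq_nonneg ((A *ᵥ p.1) i - (A *ᵥ q.1) i)]
  have hprior : ∑ j, gibbsTerm η ((p.1 j + q.1 j) / 2) ((p.2 j + q.2 j) / 2) <
      (∑ j, gibbsTerm η (p.1 j) (p.2 j) + ∑ j, gibbsTerm η (q.1 j) (q.2 j)) / 2 := by
    rw [← Finset.sum_add_distrib, Finset.sum_div]
    obtain ⟨j, hj⟩ : ∃ j, p.1 j ≠ q.1 j ∨ p.2 j ≠ q.2 j := by
      by_contra! h
      exact hne (Prod.ext (funext fun j => (h j).1) (funext fun j => (h j).2))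
    exact Finset.sum_lt_sum
      (fun j _ => gibbsTerm_midpoint_le _ _ hη (hp j) (hq j))
      ⟨j, Finset.mem_univ j, gibbsTerm_midpoint_lt hη (hp j) (hq j) hj⟩
  simp only [gibbsEnergy_eq]
  linarith

lemma continuousOn_gibbsEnergy {m n : ℕ} (A : Matrix (Fin m) (Fin n) ℝ) (b : Fin m → ℝ)
    (η : ℝ) :
    ContinuousOn (fun p : (Fin n → ℝ) × (Fin n → ℝ) => gibbsEnergy A b η p.1 p.2)
      {p | ∀ j, 0 < p.2 j} := by
  unfold gibbsEnergy
  refine ContinuousOn.add (Continuous.continuousOn ?_) (continuousOn_finsetSum _ fun j _ => ?_)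
  · have h : Continuous fun p : (Fin n → ℝ) × (Fin n → ℝ) => A *ᵥ p.1 :=
      continuous_const.matrix_mulVec continuous_fst
    fun_prop
  · have h2 : ContinuousOn (fun p : (Fin n → ℝ) × (Fin n → ℝ) => p.2 j)
        {p | ∀ j, 0 < p.2 j} := by fun_prop
    refine ContinuousOn.sub (ContinuousOn.add (ContinuousOn.div (by fun_prop) (by fun_prop) ?_) h2)
      (continuousOn_const.mul (h2.log fun p hp => (hp j).ne'))
    exact fun p hp => (mul_pos two_pos (hp j)).ne'

lemma gibbsTerm_le_of_gibbsEnergy_le {m n : ℕ} (A : Matrix (Fin m) (Fin n) ℝ)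
    (b : Fin m → ℝ) {η E : ℝ} (hη : 0 < η) {ξ lam : Fin n → ℝ} (hlam : ∀ j, 0 < lam j)
    (h : gibbsEnergy A b η ξ lam ≤ E) (j : Fin n) :
    gibbsTerm η (ξ j) (lam j) ≤
      E - n * (η - η * Real.log η) + (η - η * Real.log η) := by
  have h1 := Finset.single_le_sum
    (f := fun i => gibbsTerm η (ξ i) (lam i) - (η - η * Real.log η))
    (fun i _ => sub_nonneg.mpr (le_gibbsTerm (ξ i) hη (hlam i))) (Finset.mem_univ j)
  rw [Finset.sum_sub_distrib, Finset.sum_const, Finset.card_univ, Fintype.card_fin,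
    nsmul_eq_mul] at h1
  have h2 : 0 ≤ ∑ i, (b i - (A *ᵥ ξ) i) ^ 2 := Finset.sum_nonneg fun i _ => sq_nonneg _
  rw [gibbsEnergy_eq] at h
  linarith

lemma exists_gibbsEnergy_minimizer {m n : ℕ} (A : Matrix (Fin m) (Fin n) ℝ)
    (b : Fin m → ℝ) {η : ℝ} (hη : 0 < η) :
    ∃ p : (Fin n → ℝ) × (Fin n → ℝ), (∀ j, 0 < p.2 j) ∧
      ∀ ξ lam : Fin n → ℝ, (∀ j, 0 < lam j) →
        gibbsEnergy A b η p.1 p.2 ≤ gibbsEnergy A b η ξ lam := by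
  set E := gibbsEnergy A b η 0 1
  obtain ⟨R, a, L, ha, hbox⟩ := exists_bounds_of_gibbsTerm_le hη
    (E - n * (η - η * Real.log η) + (η - η * Real.log η))
  set K : Set ((Fin n → ℝ) × (Fin n → ℝ)) :=
    (Set.univ.pi fun _ => Set.Icc (-R) R) ×ˢ (Set.univ.pi fun _ => Set.Icc a L)
  have hmem : ∀ ξ lam : Fin n → ℝ, (∀ j, 0 < lam j) → gibbsEnergy A b η ξ lam ≤ E →
      (ξ, lam) ∈ K := fun ξ lam hlam h =>
    ⟨fun j _ => (hbox _ _ (hlam j) (gibbsTerm_le_of_gibbsEnergy_le A b hη hlam h j)).1,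
      fun j _ => (hbox _ _ (hlam j) (gibbsTerm_le_of_gibbsEnergy_le A b hη hlam h j)).2⟩
  have hpos : ∀ p ∈ K, ∀ j, 0 < p.2 j := fun p hp j =>
    ha.trans_le (hp.2 j (Set.mem_univ j)).1
  have hcompact : IsCompact K :=
    (isCompact_univ_pi fun _ => isCompact_Icc).prod (isCompact_univ_pi fun _ => isCompact_Icc)
  have hbase : ((0, 1) : (Fin n → ℝ) × (Fin n → ℝ)) ∈ K :=
    hmem 0 1 (fun _ => one_pos) le_rfl
  obtain ⟨p, hpK, hmin⟩ := hcompact.exists_isMinOn ⟨_, hbase⟩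
    ((continuousOn_gibbsEnergy A b η).mono hpos)
  have hle : ∀ q ∈ K, gibbsEnergy A b η p.1 p.2 ≤ gibbsEnergy A b η q.1 q.2 := fun q hq =>
    isMinOn_iff.mp hmin q hq
  refine ⟨p, hpos p hpK, fun ξ lam hlam => ?_⟩
  rcases le_total (gibbsEnergy A b η ξ lam) E with h | h
  · exact hle (ξ, lam) (hmem ξ lam hlam h)
  · exact (hle (0, 1) hbase).trans h

/-- For `η > 0`, the Gibbs energy functional of the gamma hypermodel has a unique global
minimizer `(ξ*, λ*)` on `ℝⁿ × (0, ∞)ⁿ`. -/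
theorem gibbsEnergy_existsUnique_minimizer {m n : ℕ} (A : Matrix (Fin m) (Fin n) ℝ)
    (b : Fin m → ℝ) (η : ℝ) (hη : 0 < η) :
    ∃! p : (Fin n → ℝ) × (Fin n → ℝ),
      (∀ j, 0 < p.2 j) ∧
      ∀ ξ lam : Fin n → ℝ, (∀ j, 0 < lam j) →
        gibbsEnergy A b η p.1 p.2 ≤ gibbsEnergy A b η ξ lam := by
  obtain ⟨p, hp, hmin⟩ := exists_gibbsEnergy_minimizer A b hη
  refine ⟨p, ⟨hp, hmin⟩, fun q ⟨hq, hqmin⟩ => ?_⟩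
  by_contra hne
  have h := gibbsEnergy_midpoint_lt A b hη hq hp hne
  have h1 := hmin q.1 q.2 hq
  have h2 := hqmin p.1 p.2 hp
  have h3 := hmin (fun j => (q.1 j + p.1 j) / 2) (fun j => (q.2 j + p.2 j) / 2)
    fun j => half_pos (add_pos (hq j) (hp j))
  linarith
end

section
/- Let A ∈ R^{m×n}, b ∈ R^m, η > 0, and let (ξ*, λ*) be a global minimizer of the Gibbs energy E(ξ, λ) = (1/2)‖b − Aξ‖^2 + sum_{j=1}^n ( ξ_j^2/(2λ_j) + λ_j − η·log λ_j ) on R^n × (0,∞)^n. Then λ*_j = (1/2)(η + sqrt(η^2 + 2(ξ*_j)^2)) for every j, and ξ* is a global minimizer of the reduced functional Ê(ξ) = E(ξ, Λ(ξ)), where Λ(ξ)_j = (1/2)(η + sqrt(η^2 + 2 ξ_j^2)). -/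
open scoped Matrix

/-- The optimal λ-update of the gamma hypermodel: `Λ(ξ)ⱼ = (η + √(η² + 2ξⱼ²))/2`. -/
noncomputable def lamUpdate {n : ℕ} (η : ℝ) (ξ : Fin n → ℝ) : Fin n → ℝ :=
  fun j => (η + Real.sqrt (η ^ 2 + 2 * (ξ j) ^ 2)) / 2

/-- A local minimizer `t > 0` of `s ↦ x² / (2s) + s - η log s` is the positive root of
`2t² - 2ηt - x² = 0`. -/
theorem eq_of_isLocalMin_gammaPenalty {η x t : ℝ} (ht : 0 < t)
    (h : IsLocalMin (fun s : ℝ => x ^ 2 / (2 * s) + s - η * Real.log s) t) :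
    t = (η + √(η ^ 2 + 2 * x ^ 2)) / 2 := by
  have hd : HasDerivAt (fun s : ℝ => x ^ 2 / (2 * s) + s - η * Real.log s)
      ((0 * (2 * t) - x ^ 2 * (2 * 1)) / (2 * t) ^ 2 + 1 - η * t⁻¹) t :=
    ((((hasDerivAt_const t (x ^ 2)).fun_div ((hasDerivAt_id' t).const_mul 2)
      (by positivity)).fun_add (hasDerivAt_id' t)).fun_sub
        ((Real.hasDerivAt_log ht.ne').const_mul η))
  have h0 := h.hasDerivAt_eq_zero hd
  have hq : η ^ 2 + 2 * x ^ 2 = (2 * t - η) ^ 2 := by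
    field_simp at h0
    linear_combination -2 * h0
  have hnonneg : 0 ≤ 2 * t - η := by
    by_contra! hneg
    nlinarith [sq_nonneg x, mul_pos ht (sub_pos.2 hneg)]
  rw [hq, Real.sqrt_sq hnonneg]
  ring

theorem lamUpdate_pos {n : ℕ} {η : ℝ} (hη : 0 < η) (ξ : Fin n → ℝ) (j : Fin n) :
    0 < lamUpdate η ξ j := by
  unfold lamUpdate
  positivity

/-- Changing a single coordinate of `lam` changes the Gibbs energy only through the
corresponding summand. -/
theorem gibbsEnergy_update_sub {m n : ℕ} (A : Matrix (Fin m) (Fin n) ℝ) (b : Fin m → ℝ)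
    (η : ℝ) (ξ lam : Fin n → ℝ) (j : Fin n) (s : ℝ) :
    gibbsEnergy A b η ξ (Function.update lam j s) - gibbsEnergy A b η ξ lam =
      ((ξ j) ^ 2 / (2 * s) + s - η * Real.log s) -
        ((ξ j) ^ 2 / (2 * lam j) + lam j - η * Real.log (lam j)) := by
  unfold gibbsEnergy
  rw [add_sub_add_left_eq_sub, ← Finset.sum_sub_distrib, Finset.sum_eq_single j]
  · simp
  · intro i _ hi
    simp [Function.update_of_ne hi]
  · simp

/-- If `(ξ*, λ*)` is a global minimizer of the Gibbs energy on `ℝⁿ × (0, ∞)ⁿ`, then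
`λ*ⱼ = (η + √(η² + 2(ξ*ⱼ)²))/2` for every `j`, and `ξ*` is a global minimizer of the
reduced functional `Ê(ξ) = E(ξ, Λ(ξ))`. -/
theorem gibbsEnergy_minimizer_lambda_eq_and_reduced {m n : ℕ}
    (A : Matrix (Fin m) (Fin n) ℝ) (b : Fin m → ℝ) (η : ℝ) (hη : 0 < η)
    (ξs lams : Fin n → ℝ) (hpos : ∀ j, 0 < lams j)
    (hmin : ∀ ξ lam : Fin n → ℝ, (∀ j, 0 < lam j) →
      gibbsEnergy A b η ξs lams ≤ gibbsEnergy A b η ξ lam) :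
    (∀ j, lams j = (η + Real.sqrt (η ^ 2 + 2 * (ξs j) ^ 2)) / 2) ∧
    (∀ ξ : Fin n → ℝ,
      gibbsEnergy A b η ξs (lamUpdate η ξs) ≤ gibbsEnergy A b η ξ (lamUpdate η ξ)) := by
  have hlam : ∀ j, lams j = (η + √(η ^ 2 + 2 * (ξs j) ^ 2)) / 2 := by
    intro j
    refine eq_of_isLocalMin_gammaPenalty (hpos j) ?_
    filter_upwards [lt_mem_nhds (hpos j)] with s hs
    have hle := hmin ξs (Function.update lams j s) fun i => by
      rcases eq_or_ne i j with rfl | hi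
      · simpa using hs
      · simpa [Function.update_of_ne hi] using hpos i
    linarith [gibbsEnergy_update_sub A b η ξs lams j s]
  refine ⟨hlam, fun ξ => ?_⟩
  rw [← show lams = lamUpdate η ξs from funext hlam]
  exact hmin ξ _ (lamUpdate_pos hη ξ)
end

section
/- Let A ∈ R^{m×n}, b ∈ R^m, and fix ξ ∈ R^n. For η > 0, set λ_j(η) = (1/2)(η + sqrt(η^2 + 2 ξ_j^2)) and Ê_η(ξ) = (1/2)‖b − Aξ‖^2 + sum_{j=1}^n ( ξ_j^2/(2 λ_j(η)) + λ_j(η) − η·log λ_j(η) ). Then Ê_η(ξ) converges, as η → 0+, to (1/2)‖b − Aξ‖^2 + sqrt(2)·sum_{j=1}^n |ξ_j|. -/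
open scoped Matrix

/-- The Gibbs energy functional of the gamma hypermodel (`r = 1`, `η = β - 3/2 > 0`) with a
linear forward model `A`, restricted to the manifold `λⱼ = (η + √(η² + 2ξⱼ²))/2` given by the
optimal λ-update. -/
noncomputable def reducedGibbsEnergy {m n : ℕ} (A : Matrix (Fin m) (Fin n) ℝ) (b : Fin m → ℝ)
    (η : ℝ) (ξ : Fin n → ℝ) : ℝ :=
  (1 / 2) * ∑ i, (b i - (A *ᵥ ξ) i) ^ 2
    + ∑ j, ((ξ j) ^ 2 / (2 * ((η + Real.sqrt (η ^ 2 + 2 * (ξ j) ^ 2)) / 2))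
          + (η + Real.sqrt (η ^ 2 + 2 * (ξ j) ^ 2)) / 2
          - η * Real.log ((η + Real.sqrt (η ^ 2 + 2 * (ξ j) ^ 2)) / 2))

/-- Each coordinate's contribution to the reduced Gibbs energy converges to `√2·|x|`. -/
theorem reducedGibbsEnergy_summand_tendsto (x : ℝ) :
    Filter.Tendsto (fun η : ℝ => x ^ 2 / (2 * ((η + Real.sqrt (η ^ 2 + 2 * x ^ 2)) / 2))
          + (η + Real.sqrt (η ^ 2 + 2 * x ^ 2)) / 2
          - η * Real.log ((η + Real.sqrt (η ^ 2 + 2 * x ^ 2)) / 2))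
      (nhdsWithin 0 (Set.Ioi 0)) (nhds (Real.sqrt 2 * |x|)) := by
  rcases eq_or_ne x 0 with rfl | hx
  · have h : Filter.Tendsto (fun η : ℝ => η - η * Real.log η)
        (nhdsWithin 0 (Set.Ioi 0)) (nhds (Real.sqrt 2 * |0|)) := by
      have hc : Continuous fun η : ℝ => η - η * Real.log η :=
        continuous_id.sub Real.continuous_mul_log
      simpa using (hc.tendsto 0).mono_left nhdsWithin_le_nhds
    refine h.congr' ?_
    filter_upwards [self_mem_nhdsWithin] with η hη
    have hη : 0 < η := hη
    simp [Real.sqrt_sq hη.le]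
  · have hsqrt : Real.sqrt (2 * x ^ 2) = Real.sqrt 2 * |x| := by
      rw [Real.sqrt_mul zero_le_two, Real.sqrt_sq_eq_abs]
    have hpos : 0 < Real.sqrt 2 * |x| := by positivity
    have hc : ContinuousAt (fun η : ℝ => x ^ 2 / (2 * ((η + Real.sqrt (η ^ 2 + 2 * x ^ 2)) / 2))
          + (η + Real.sqrt (η ^ 2 + 2 * x ^ 2)) / 2
          - η * Real.log ((η + Real.sqrt (η ^ 2 + 2 * x ^ 2)) / 2)) 0 := by
      have hl : ContinuousAt (fun η : ℝ => (η + Real.sqrt (η ^ 2 + 2 * x ^ 2)) / 2) 0 := by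
        fun_prop
      have hne : ((0 : ℝ) + Real.sqrt (0 ^ 2 + 2 * x ^ 2)) / 2 ≠ 0 := by
        rw [zero_pow two_ne_zero, zero_add, zero_add, hsqrt]
        positivity
      exact ((continuousAt_const.div (continuousAt_const.mul hl)
        (mul_ne_zero two_ne_zero hne)).add hl).sub (continuousAt_id.mul (hl.log hne))
    have hval : x ^ 2 / (2 * ((0 + Real.sqrt (0 ^ 2 + 2 * x ^ 2)) / 2))
          + (0 + Real.sqrt (0 ^ 2 + 2 * x ^ 2)) / 2
          - 0 * Real.log ((0 + Real.sqrt (0 ^ 2 + 2 * x ^ 2)) / 2) = Real.sqrt 2 * |x| := by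
      rw [zero_pow two_ne_zero, zero_add, zero_add, hsqrt, zero_mul, sub_zero]
      have hsq : (Real.sqrt 2 * |x|) ^ 2 = 2 * x ^ 2 := by
        rw [mul_pow, Real.sq_sqrt zero_le_two, sq_abs]
      generalize Real.sqrt 2 * |x| = s at hpos hsq
      field_simp
      linarith
    have h := hc.tendsto
    rw [hval] at h
    exact h.mono_left nhdsWithin_le_nhds

/-- As `η → 0+`, the reduced Gibbs energy `Ê_η(ξ)` converges to
`(1/2)‖b - Aξ‖² + √2·∑ⱼ |ξⱼ|`. -/
theorem reducedGibbsEnergy_tendsto {m n : ℕ} (A : Matrix (Fin m) (Fin n) ℝ)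
    (b : Fin m → ℝ) (ξ : Fin n → ℝ) :
    Filter.Tendsto (fun η : ℝ => reducedGibbsEnergy A b η ξ)
      (nhdsWithin 0 (Set.Ioi 0))
      (nhds ((1 / 2) * ∑ i, (b i - (A *ᵥ ξ) i) ^ 2 + Real.sqrt 2 * ∑ j, |ξ j|)) := by
  rw [Finset.mul_sum _ _ (Real.sqrt 2)]
  exact tendsto_const_nhds.add
    (tendsto_finsetSum _ fun j _ => reducedGibbsEnergy_summand_tendsto (ξ j))
end

section
/- Let A ∈ R^{m×n}, b ∈ R^m, η > 0, and let (ξ*, λ*) be the unique global minimizer of the Gibbs energy E(ξ, λ) = (1/2)‖b − Aξ‖^2 + sum_{j=1}^n ( ξ_j^2/(2λ_j) + λ_j − η·log λ_j ) on R^n × (0,∞)^n. Let λ^0 ∈ (0,∞)^n be arbitrary, and let the IAS sequence be defined for t ≥ 1 by: ξ^t is the unique minimizer over R^n of ξ ↦ E(ξ, λ^{t−1}), and λ^t_j = (1/2)(η + sqrt(η^2 + 2 (ξ^t_j)^2)) for each j. Then the sequence (ξ^t, λ^t) converges to (ξ*, λ*) as t → ∞. -/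
open scoped Matrix

open Filter Topology

/-- The tangent-plane inequality for the jointly convex map
`(x, l) ↦ x ^ 2 / (2 * l) + l - η * log l`, at a point where its `l`-derivative vanishes. -/
lemma gammaPenalty_tangent_lt {η x l y k : ℝ} (hη : 0 < η) (hl : 0 < l) (hk : 0 < k)
    (h : l ^ 2 - η * l = x ^ 2 / 2) (hne : k ≠ l) :
    x ^ 2 / (2 * l) + l - η * Real.log l + x / l * (y - x) <
      y ^ 2 / (2 * k) + k - η * Real.log k := by
  have h1 : x / l * y - (x / l) ^ 2 * k / 2 ≤ y ^ 2 / (2 * k) := by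
    rw [le_div_iff₀ (by positivity)]
    nlinarith [sq_nonneg (y - x / l * k)]
  have h2 : Real.log k - Real.log l < k / l - 1 := by
    rw [← Real.log_div hk.ne' hl.ne']
    exact Real.log_lt_sub_one_of_pos (by positivity) (by rwa [Ne, div_eq_one_iff_eq hl.ne'])
  have h3 : x ^ 2 / (2 * l) + l + x / l * (y - x) =
      x / l * y - (x / l) ^ 2 * k / 2 + k - η * (k / l - 1) := by
    have hx : x ^ 2 = 2 * (l ^ 2 - η * l) := by linarith
    field_simp
    linear_combination (-l + k) * hx
  nlinarith [mul_lt_mul_of_pos_left h2 hη]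

lemma gammaPenalty_tangent_le {η x l y k : ℝ} (hη : 0 < η) (hl : 0 < l) (hk : 0 < k)
    (h : l ^ 2 - η * l = x ^ 2 / 2) :
    x ^ 2 / (2 * l) + l - η * Real.log l + x / l * (y - x) ≤
      y ^ 2 / (2 * k) + k - η * Real.log k := by
  rcases eq_or_ne k l with rfl | hne
  · have : y ^ 2 / (2 * k) - (x ^ 2 / (2 * k) + x / k * (y - x)) = (y - x) ^ 2 / (2 * k) := by
      field_simp
      ring
    have : 0 ≤ (y - x) ^ 2 / (2 * k) := by positivity
    linarith
  · exact (gammaPenalty_tangent_lt hη hl hk h hne).le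

lemma abs_add_le_gammaPenalty {η x l : ℝ} (hη : 0 < η) (hl : 0 < l) :
    |x| + (η - η * Real.log (2 * η)) ≤ x ^ 2 / (2 * l) + l - η * Real.log l ∧
      l / 2 + (η - η * Real.log (2 * η)) ≤ x ^ 2 / (2 * l) + l - η * Real.log l := by
  have h1 : Real.log l - Real.log (2 * η) ≤ l / (2 * η) - 1 := by
    rw [← Real.log_div hl.ne' (by positivity)]
    exact Real.log_le_sub_one_of_pos (by positivity)
  have h2 : η * (l / (2 * η) - 1) = l / 2 - η := by field_simp
  have h3 := mul_le_mul_of_nonneg_left h1 hη.le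
  have h4 : |x| ≤ x ^ 2 / (2 * l) + l / 2 := by
    rw [← sub_nonneg, ← sq_abs x]
    have : |x| ^ 2 / (2 * l) + l / 2 - |x| = (|x| - l) ^ 2 / (2 * l) := by
      field_simp
      ring
    rw [this]
    positivity
  have h5 : 0 ≤ x ^ 2 / (2 * l) := by positivity
  constructor <;> nlinarith

lemma gammaUpdate_ge (η x : ℝ) :
    η ≤ (η + √(η ^ 2 + 2 * x ^ 2)) / 2 := by
  have : η ≤ √(η ^ 2 + 2 * x ^ 2) := Real.le_sqrt_of_sq_le (by nlinarith [sq_nonneg x])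
  linarith

lemma gammaUpdate_stationary (η x : ℝ) :
    ((η + √(η ^ 2 + 2 * x ^ 2)) / 2) ^ 2 - η * ((η + √(η ^ 2 + 2 * x ^ 2)) / 2) = x ^ 2 / 2 := by
  have := Real.sq_sqrt (show 0 ≤ η ^ 2 + 2 * x ^ 2 by positivity)
  linear_combination this / 4

section

variable {m n : ℕ} (A : Matrix (Fin m) (Fin n) ℝ) (b : Fin m → ℝ) {η : ℝ}

/-- First-order optimality of a minimizer of `ξ ↦ E(ξ, l)`. -/
lemma gibbsEnergy_stationary {x l : Fin n → ℝ}
    (h : ∀ ξ, gibbsEnergy A b η x l ≤ gibbsEnergy A b η ξ l) (d : Fin n → ℝ) :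
    ∑ j, x j / l j * d j = ∑ i, (b i - (A *ᵥ x) i) * (A *ᵥ d) i := by
  have key : ∀ e : ℝ, gibbsEnergy A b η (x + e • d) l = gibbsEnergy A b η x l +
      (1 / 2 * ∑ i, (A *ᵥ d) i ^ 2 + ∑ j, d j ^ 2 / (2 * l j)) * (e * e) +
      (∑ j, x j / l j * d j - ∑ i, (b i - (A *ᵥ x) i) * (A *ᵥ d) i) * e := by
    intro e
    have h1 : ∀ i, (b i - (A *ᵥ (x + e • d)) i) ^ 2 = (b i - (A *ᵥ x) i) ^ 2 +
        (A *ᵥ d) i ^ 2 * (e * e) - 2 * e * ((b i - (A *ᵥ x) i) * (A *ᵥ d) i) := by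
      intro i
      simp only [Matrix.mulVec_add, Matrix.mulVec_smul, Pi.add_apply, Pi.smul_apply, smul_eq_mul]
      ring
    have h2 : ∀ j, (x + e • d) j ^ 2 / (2 * l j) + l j - η * Real.log (l j) =
        (x j ^ 2 / (2 * l j) + l j - η * Real.log (l j)) + d j ^ 2 / (2 * l j) * (e * e) +
          x j / l j * d j * e := by
      intro j
      simp only [Pi.add_apply, Pi.smul_apply, smul_eq_mul, div_eq_mul_inv, mul_inv]
      ring
    simp only [gibbsEnergy, h1, h2, Finset.sum_add_distrib, Finset.sum_sub_distrib,
      ← Finset.sum_mul, ← Finset.mul_sum]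
    ring
  have := discrim_le_zero (a := 1 / 2 * ∑ i, (A *ᵥ d) i ^ 2 + ∑ j, d j ^ 2 / (2 * l j))
    (b := ∑ j, x j / l j * d j - ∑ i, (b i - (A *ᵥ x) i) * (A *ᵥ d) i) (c := 0) fun e => by
      linarith [h (x + e • d), key e]
  rw [discrim, mul_zero, sub_zero] at this
  exact sub_eq_zero.1 (pow_eq_zero_iff two_ne_zero |>.1 (le_antisymm this (sq_nonneg _)))

/-- A point that is optimal in each of its two blocks is a global minimizer. -/
lemma gibbsEnergy_le_of_stationary (hη : 0 < η) {x l : Fin n → ℝ} (hl : ∀ j, 0 < l j)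
    (h : ∀ ξ, gibbsEnergy A b η x l ≤ gibbsEnergy A b η ξ l)
    (hs : ∀ j, l j ^ 2 - η * l j = x j ^ 2 / 2) (y k : Fin n → ℝ) (hk : ∀ j, 0 < k j) :
    gibbsEnergy A b η x l ≤ gibbsEnergy A b η y k := by
  have h0 := gibbsEnergy_stationary A b h (y - x)
  have h1 := Finset.sum_le_sum fun j (_ : j ∈ Finset.univ) =>
    gammaPenalty_tangent_le (y := y j) hη (hl j) (hk j) (hs j)
  have h2 : ∑ i, ((b i - (A *ᵥ x) i) ^ 2 - 2 * ((b i - (A *ᵥ x) i) * (A *ᵥ (y - x)) i)) ≤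
      ∑ i, (b i - (A *ᵥ y) i) ^ 2 := by
    refine Finset.sum_le_sum fun i _ => ?_
    rw [Matrix.mulVec_sub, Pi.sub_apply]
    nlinarith [sq_nonneg ((A *ᵥ y) i - (A *ᵥ x) i)]
  rw [Finset.sum_sub_distrib, ← Finset.mul_sum] at h2
  rw [Finset.sum_add_distrib] at h1
  simp only [Pi.sub_apply] at h0
  unfold gibbsEnergy
  linarith

lemma gibbsEnergy_le_of_hyper_stationary (hη : 0 < η) {x l k : Fin n → ℝ} (hl : ∀ j, 0 < l j)
    (hk : ∀ j, 0 < k j) (hs : ∀ j, l j ^ 2 - η * l j = x j ^ 2 / 2) :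
    gibbsEnergy A b η x l ≤ gibbsEnergy A b η x k := by
  refine add_le_add_right (Finset.sum_le_sum fun j _ => ?_) _
  simpa using gammaPenalty_tangent_le (y := x j) hη (hl j) (hk j) (hs j)

lemma eq_of_gibbsEnergy_le (hη : 0 < η) {x l k : Fin n → ℝ} (hl : ∀ j, 0 < l j)
    (hk : ∀ j, 0 < k j) (hs : ∀ j, l j ^ 2 - η * l j = x j ^ 2 / 2)
    (h : gibbsEnergy A b η x k ≤ gibbsEnergy A b η x l) : k = l := by
  by_contra hne
  obtain ⟨j, hj⟩ := Function.ne_iff.1 hne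
  refine h.not_gt (add_lt_add_right (Finset.sum_lt_sum (fun j _ => ?_)
    ⟨j, Finset.mem_univ j, ?_⟩) _)
  · simpa using gammaPenalty_tangent_le (y := x j) hη (hl j) (hk j) (hs j)
  · simpa using gammaPenalty_tangent_lt (y := x j) hη (hl j) (hk j) (hs j) hj

lemma continuousAt_gibbsEnergy {x l : Fin n → ℝ} (hl : ∀ j, 0 < l j) :
    ContinuousAt (fun p : (Fin n → ℝ) × (Fin n → ℝ) => gibbsEnergy A b η p.1 p.2) (x, l) := by
  have h1 : Continuous fun p : (Fin n → ℝ) × (Fin n → ℝ) =>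
      (1 / 2) * ∑ i, (b i - (A *ᵥ p.1) i) ^ 2 := by
    simp only [Matrix.mulVec, dotProduct]
    fun_prop
  refine h1.continuousAt.add (tendsto_finsetSum _ fun j _ => ?_)
  have hx : ContinuousAt (fun p : (Fin n → ℝ) × (Fin n → ℝ) => p.1 j) (x, l) := by fun_prop
  have hp : ContinuousAt (fun p : (Fin n → ℝ) × (Fin n → ℝ) => p.2 j) (x, l) := by fun_prop
  exact (((hx.pow 2).div (hp.const_mul 2) (mul_pos two_pos (hl j)).ne').add hp).sub
    ((hp.log (hl j).ne').const_mul η)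

/-- Sublevel sets of the Gibbs energy are bounded. -/
lemma abs_le_and_le_of_gibbsEnergy_le (hη : 0 < η) (C : ℝ) : ∃ K, ∀ x l : Fin n → ℝ,
    (∀ j, 0 < l j) → gibbsEnergy A b η x l ≤ C → ∀ j, |x j| ≤ K ∧ l j ≤ 2 * K := by
  refine ⟨C - n * (η - η * Real.log (2 * η)), fun x l hl h j => ?_⟩
  have hsum : ∑ i, (x i ^ 2 / (2 * l i) + l i - η * Real.log (l i) -
      (η - η * Real.log (2 * η))) ≤ C - n * (η - η * Real.log (2 * η)) := by
    have : 0 ≤ ∑ i, (b i - (A *ᵥ x) i) ^ 2 := Finset.sum_nonneg fun i _ => sq_nonneg _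
    unfold gibbsEnergy at h
    rw [Finset.sum_sub_distrib, Finset.sum_const, Finset.card_univ, Fintype.card_fin,
      nsmul_eq_mul]
    linarith
  have hj := (Finset.single_le_sum (fun i _ => ?_) (Finset.mem_univ j)).trans hsum
  · have := abs_add_le_gammaPenalty (x := x j) hη (hl j)
    constructor <;> linarith
  · have := abs_add_le_gammaPenalty (x := x i) hη (hl i)
    linarith [abs_nonneg (x i)]

end

/-- Convergence of the IAS algorithm for the gamma hypermodel: if `(ξ*, λ*)` is the unique
global minimizer of the Gibbs energy on `ℝⁿ × (0, ∞)ⁿ`, and the IAS sequence starts from an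
arbitrary `λ⁰ ∈ (0, ∞)ⁿ`, updating at every step `ξᵗ` as the minimizer of `ξ ↦ E(ξ, λᵗ⁻¹)`
and `λᵗⱼ = (η + √(η² + 2(ξᵗⱼ)²))/2`, then `(ξᵗ, λᵗ) → (ξ*, λ*)` as `t → ∞`. -/
theorem ias_converges {m n : ℕ} (A : Matrix (Fin m) (Fin n) ℝ) (b : Fin m → ℝ)
    (η : ℝ) (hη : 0 < η)
    (ξs lams : Fin n → ℝ) (hpos : ∀ j, 0 < lams j)
    (hmin : ∀ ξ lam : Fin n → ℝ, (∀ j, 0 < lam j) →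
      gibbsEnergy A b η ξs lams ≤ gibbsEnergy A b η ξ lam)
    (huniq : ∀ ξ' lam' : Fin n → ℝ, (∀ j, 0 < lam' j) →
      (∀ ξ lam : Fin n → ℝ, (∀ j, 0 < lam j) →
        gibbsEnergy A b η ξ' lam' ≤ gibbsEnergy A b η ξ lam) →
      ξ' = ξs ∧ lam' = lams)
    (ξseq lamseq : ℕ → Fin n → ℝ) (hlam0 : ∀ j, 0 < lamseq 0 j)
    (hξ : ∀ t : ℕ, ∀ ξ : Fin n → ℝ,
      gibbsEnergy A b η (ξseq (t + 1)) (lamseq t) ≤ gibbsEnergy A b η ξ (lamseq t))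
    (hlam : ∀ t : ℕ, ∀ j,
      lamseq (t + 1) j = (η + Real.sqrt (η ^ 2 + 2 * (ξseq (t + 1) j) ^ 2)) / 2) :
    Filter.Tendsto (fun t => (ξseq t, lamseq t)) Filter.atTop (nhds (ξs, lams)) := by
  have hge : ∀ t j, η ≤ lamseq (t + 1) j := fun t j => hlam t j ▸ gammaUpdate_ge _ _
  have hlpos : ∀ t j, 0 < lamseq t j
    | 0, j => hlam0 j
    | t + 1, j => hη.trans_le (hge t j)
  have hstat : ∀ t j, lamseq (t + 1) j ^ 2 - η * lamseq (t + 1) j = ξseq (t + 1) j ^ 2 / 2 :=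
    fun t j => hlam t j ▸ gammaUpdate_stationary η _
  set F : ℕ → ℝ := fun t => gibbsEnergy A b η (ξseq (t + 1)) (lamseq t) with hF
  set G : ℕ → ℝ := fun t => gibbsEnergy A b η (ξseq (t + 1)) (lamseq (t + 1)) with hG
  have hGF : ∀ t, G t ≤ F t := fun t =>
    gibbsEnergy_le_of_hyper_stationary A b hη (hlpos (t + 1)) (hlpos t) (hstat t)
  have hFG : ∀ t, F (t + 1) ≤ G t := fun t => hξ (t + 1) _
  have hanti : Antitone F := antitone_nat_of_succ_le fun t => (hFG t).trans (hGF t)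
  obtain ⟨L, hL⟩ : ∃ L, Tendsto F atTop (𝓝 L) :=
    ⟨_, tendsto_atTop_ciInf hanti ⟨gibbsEnergy A b η ξs lams, by
      rintro _ ⟨t, rfl⟩
      exact hmin _ _ (hlpos t)⟩⟩
  have hLG : Tendsto G atTop (𝓝 L) :=
    tendsto_of_tendsto_of_tendsto_of_le_of_le ((tendsto_add_atTop_iff_nat 1).2 hL) hL hFG hGF
  obtain ⟨K, hK⟩ := abs_le_and_le_of_gibbsEnergy_le A b hη (F 0)
  let S : Set ((Fin n → ℝ) × (Fin n → ℝ)) :=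
    Set.Icc (fun _ => -K) (fun _ => K) ×ˢ Set.Icc (fun _ => η) (fun _ => 2 * K)
  have hmem : ∀ t, (ξseq (t + 2), lamseq (t + 1)) ∈ S := fun t => by
    have h := hK _ _ (hlpos (t + 1)) (hanti (Nat.zero_le (t + 1)))
    exact ⟨⟨fun j => (abs_le.1 (h j).1).1, fun j => (abs_le.1 (h j).1).2⟩,
      fun j => hge t j, fun j => (h j).2⟩
  have hlim : Tendsto (fun t => (ξseq (t + 2), lamseq (t + 1))) atTop (𝓝 (ξs, lams)) := by
    refine tendsto_of_subseq_tendsto fun ns hns => ?_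
    obtain ⟨⟨x, l⟩, hxl, φ, hφ, hconv⟩ :=
      (isCompact_Icc.prod isCompact_Icc : IsCompact S).tendsto_subseq fun k => hmem (ns k)
    refine ⟨φ, ?_⟩
    have hsub : Tendsto (fun k => ns (φ k) + 1) atTop atTop :=
      (tendsto_add_atTop_nat 1).comp (hns.comp hφ.tendsto_atTop)
    have hl : ∀ j, 0 < l j := fun j => hη.trans_le (hxl.2.1 j)
    have hcx : Tendsto (fun k => ξseq (ns (φ k) + 2)) atTop (𝓝 x) :=
      (continuous_fst.tendsto _).comp hconv
    have hcl : Tendsto (fun k => lamseq (ns (φ k) + 1)) atTop (𝓝 l) :=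
      (continuous_snd.tendsto _).comp hconv
    set l' : Fin n → ℝ := fun j => (η + √(η ^ 2 + 2 * x j ^ 2)) / 2 with hl'
    have hl'pos : ∀ j, 0 < l' j := fun j => hη.trans_le (gammaUpdate_ge _ _)
    have hcl' : Tendsto (fun k => lamseq (ns (φ k) + 2)) atTop (𝓝 l') := by
      have hg : Continuous fun (y : Fin n → ℝ) j => (η + √(η ^ 2 + 2 * y j ^ 2)) / 2 := by
        fun_prop
      exact ((hg.tendsto x).comp hcx).congr fun k => (funext (hlam (ns (φ k) + 1))).symm
    have hE : gibbsEnergy A b η x l = L := tendsto_nhds_unique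
      ((continuousAt_gibbsEnergy A b hl).tendsto.comp (hcx.prodMk_nhds hcl)) (hL.comp hsub)
    have hE' : gibbsEnergy A b η x l' = L := tendsto_nhds_unique
      ((continuousAt_gibbsEnergy A b hl'pos).tendsto.comp (hcx.prodMk_nhds hcl'))
      (hLG.comp hsub)
    have hstat' : ∀ j, l' j ^ 2 - η * l' j = x j ^ 2 / 2 := fun j => gammaUpdate_stationary η _
    have hll' : l = l' := eq_of_gibbsEnergy_le A b hη hl'pos hl hstat' (hE.trans hE'.symm).le
    have hxmin : ∀ ξ, gibbsEnergy A b η x l ≤ gibbsEnergy A b η ξ l := fun ξ =>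
      le_of_tendsto_of_tendsto'
        ((continuousAt_gibbsEnergy A b hl).tendsto.comp (hcx.prodMk_nhds hcl))
        ((continuousAt_gibbsEnergy A b hl).tendsto.comp (tendsto_const_nhds.prodMk_nhds hcl))
        fun k => hξ (ns (φ k) + 1) ξ
    obtain ⟨rfl, rfl⟩ := huniq x l hl
      (gibbsEnergy_le_of_stationary A b hη hl hxmin (hll' ▸ hstat'))
    exact hconv
  exact ((tendsto_add_atTop_iff_nat 2).1 ((continuous_fst.tendsto _).comp hlim)).prodMk_nhds
    ((tendsto_add_atTop_iff_nat 1).1 ((continuous_snd.tendsto _).comp hlim))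
end

section
/- Let r ≠ 0 and β be real numbers, and let φ : R → R be positive on (0, ∞), differentiable at a point t > 0, and satisfy r·φ(s)^{r+1} − (rβ − 3/2)·φ(s) = s^2/2 for all s > 0 (real powers). If 2·r^2·φ(t)^{r+1} + t^2 ≠ 0, then the derivative of φ at t equals 2·t·φ(t) / (2·r^2·φ(t)^{r+1} + t^2). -/
/-- Implicit differentiation of the first-order optimality condition for the λ-update of the
IAS algorithm with a generalized gamma hyperprior `(r, β)`: if `φ` is positive on `(0, ∞)`,
differentiable at `t > 0`, and satisfies `r·φ(s)^(r+1) - (rβ - 3/2)·φ(s) = s²/2` for all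
`s > 0`, and `2r²·φ(t)^(r+1) + t² ≠ 0`, then `φ'(t) = 2tφ(t)/(2r²·φ(t)^(r+1) + t²)`. -/
theorem ias_lambda_update_ode (r β : ℝ) (hr : r ≠ 0) (φ : ℝ → ℝ)
    (hφpos : ∀ s : ℝ, 0 < s → 0 < φ s) (t : ℝ) (ht : 0 < t)
    (hφdiff : DifferentiableAt ℝ φ t)
    (hφeq : ∀ s : ℝ, 0 < s → r * φ s ^ (r + 1) - (r * β - 3 / 2) * φ s = s ^ 2 / 2)
    (hden : 2 * r ^ 2 * φ t ^ (r + 1) + t ^ 2 ≠ 0) :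
    deriv φ t = 2 * t * φ t / (2 * r ^ 2 * φ t ^ (r + 1) + t ^ 2) := by
  have hpos := hφpos t ht
  have hφ := hφdiff.hasDerivAt
  have hleft : HasDerivAt (fun s => r * φ s ^ (r + 1) - (r * β - 3 / 2) * φ s)
      (r * (deriv φ t * (r + 1) * φ t ^ r) - (r * β - 3 / 2) * deriv φ t) t := by
    have hpow := hφ.rpow_const (p := r + 1) (Or.inl hpos.ne')
    rw [add_sub_cancel_right] at hpow
    exact (hpow.const_mul r).sub (hφ.const_mul _)
  have hright : HasDerivAt (fun s : ℝ => s ^ 2 / 2) t t := by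
    simpa using (hasDerivAt_pow 2 t).div_const 2
  have heq : (fun s => r * φ s ^ (r + 1) - (r * β - 3 / 2) * φ s) =ᶠ[nhds t]
      fun s => s ^ 2 / 2 := by
    filter_upwards [Ioi_mem_nhds ht] with s hs using hφeq s hs
  have hderiv := hleft.unique (hright.congr_of_eventuallyEq heq)
  have hrpow : φ t ^ (r + 1) = φ t ^ r * φ t := Real.rpow_add_one hpos.ne' r
  have hopt := hφeq t ht
  rw [eq_div_iff hden]
  rw [hrpow] at hopt ⊢
  linear_combination 2 * φ t * hderiv - 2 * deriv φ t * hopt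
end

section
/- Let 0 ≤ k ≤ 1 and let μ be the product of four independent standard Gaussian measures N(0,1) on R^4, with coordinates (x1, x2, w1, w2). Define f(x1, x2, w1, w2) = sqrt( (1 − k^2)·(x1^2 + x2^2) + 2·k·sqrt(1 − k^2)·sqrt(x1^2 + x2^2)·w1 + k^2·(w1^2 + w2^2) ) and g(x1, x2, w1, w2) = sqrt(x1^2 + x2^2). Then the pushforward measures of μ under f and under g are equal; in particular, if X ~ N(0, I_2) and W ~ N(0, I_2) are independent and R = ‖X‖, then ( (1 − k^2)·R^2 + 2·k·sqrt(1 − k^2)·R·W_1 + k^2·‖W‖^2 )^{1/2} has the same Rayleigh(1) distribution as R. -/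
open MeasureTheory ProbabilityTheory

lemma stdGaussian_prod_map_smul_add_smul {E : Type*} [NormedAddCommGroup E]
    [InnerProductSpace ℝ E] [FiniteDimensional ℝ E] [MeasurableSpace E] [BorelSpace E]
    {a b : ℝ} (hab : a ^ 2 + b ^ 2 = 1) :
    ((stdGaussian E).prod (stdGaussian E)).map (fun p => a • p.1 + b • p.2) = stdGaussian E := by
  have h : ((stdGaussian E).prod (stdGaussian E)).map (fun p => a • p.1 + b • p.2)
      = ((stdGaussian E).map (a • ·)).conv ((stdGaussian E).map (b • ·)) := by
    rw [Measure.conv, Measure.map_prod_map _ _ (by fun_prop) (by fun_prop),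
      Measure.map_map (by fun_prop) (by fun_prop)]
    rfl
  rw [h]
  have := Measure.isProbabilityMeasure_map (μ := stdGaussian E) (f := (a • ·)) (by fun_prop)
  have := Measure.isProbabilityMeasure_map (μ := stdGaussian E) (f := (b • ·)) (by fun_prop)
  apply Measure.ext_of_charFun
  ext t
  rw [charFun_conv, charFun_map_smul, charFun_map_smul, charFun_stdGaussian,
    charFun_stdGaussian, charFun_stdGaussian, ← Complex.exp_add, norm_smul, norm_smul]
  norm_cast
  congr 1
  rw [mul_pow, mul_pow, Real.norm_eq_abs, Real.norm_eq_abs, sq_abs, sq_abs]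
  linear_combination (-‖t‖ ^ 2 / 2) * hab

lemma measurePreserving_stdGaussian_rotate_snd :
    MeasurePreserving
      (fun p : ℂ × ℂ => (p.1, (Circle.exp p.1.arg : ℂ) * p.2))
      ((stdGaussian ℂ).prod (stdGaussian ℂ)) ((stdGaussian ℂ).prod (stdGaussian ℂ)) := by
  refine (MeasurePreserving.id _).skew_product (g := fun (z : ℂ) w => (Circle.exp z.arg : ℂ) * w) ?_ ?_
  · simp only [Circle.coe_exp]
    fun_prop
  · exact .of_forall fun z => stdGaussian_map (rotation (Circle.exp z.arg))

lemma map_norm_smul_norm_add_smul {a b : ℝ} (hab : a ^ 2 + b ^ 2 = 1) :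
    ((stdGaussian ℂ).prod (stdGaussian ℂ)).map (fun p => ‖(a * ‖p.1‖ + b * p.2 : ℂ)‖)
      = (stdGaussian ℂ).map (fun z => ‖z‖) := by
  have h : (fun p : ℂ × ℂ => ‖(a * ‖p.1‖ + b * p.2 : ℂ)‖)
      = (fun z : ℂ => ‖z‖) ∘ (fun p : ℂ × ℂ => a • p.1 + b • p.2)
        ∘ (fun p : ℂ × ℂ => (p.1, (Circle.exp p.1.arg : ℂ) * p.2)) := by
    ext ⟨z, w⟩
    have hz : a • z + b • ((Circle.exp z.arg : ℂ) * w)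
        = (Circle.exp z.arg : ℂ) * (a * ‖z‖ + b * w) := by
      conv_lhs => enter [1, 2]; rw [← Complex.norm_mul_exp_arg_mul_I z]
      simp only [Circle.coe_exp, Complex.real_smul]
      ring
    simp only [Function.comp_apply, hz, norm_mul, Circle.norm_coe, one_mul]
  rw [h, ← Measure.map_map (by fun_prop)
      (.comp (by fun_prop) measurePreserving_stdGaussian_rotate_snd.measurable),
    ← Measure.map_map (by fun_prop) measurePreserving_stdGaussian_rotate_snd.measurable,
    measurePreserving_stdGaussian_rotate_snd.map_eq, stdGaussian_prod_map_smul_add_smul hab]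

lemma pi_gaussianReal_map_complex {ι : Type*} [Fintype ι] {i j : ι} (hij : i ≠ j) :
    (Measure.pi fun _ : ι => gaussianReal 0 1).map (fun p => (⟨p i, p j⟩ : ℂ))
      = stdGaussian ℂ := by
  have hinj : Function.Injective ![i, j] := by
    intro x y h
    fin_cases x <;> fin_cases y <;> simp_all [eq_comm]
  have hind : iIndepFun (fun (l : ι) (p : ι → ℝ) => p l)
      (Measure.pi fun _ : ι => gaussianReal 0 1) :=
    iIndepFun_pi (X := fun _ => id) fun _ => aemeasurable_id
  have hpi := (iIndepFun_iff_map_fun_eq_pi_map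
    (fun _ => (measurable_pi_apply _).aemeasurable)).1 (hind.precomp hinj)
  simp only [(measurePreserving_eval (fun _ : ι => gaussianReal 0 1) _).map_eq] at hpi
  rw [stdGaussian_eq_map_pi_orthonormalBasis Complex.orthonormalBasisOneI, ← hpi,
    Measure.map_map (by fun_prop) (by fun_prop)]
  congr 1
  ext p
  simp [Complex.ext_iff]

lemma pi_gaussianReal_map_complex_prod :
    (Measure.pi fun _ : Fin 4 => gaussianReal 0 1).map
        (fun p => ((⟨p 0, p 1⟩, ⟨p 2, p 3⟩) : ℂ × ℂ))
      = (stdGaussian ℂ).prod (stdGaussian ℂ) := by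
  have hind : iIndepFun (fun (l : Fin 4) (p : Fin 4 → ℝ) => p l)
      (Measure.pi fun _ : Fin 4 => gaussianReal 0 1) :=
    iIndepFun_pi (X := fun _ => id) fun _ => aemeasurable_id
  have hm : Measurable fun q : ℝ × ℝ => (⟨q.1, q.2⟩ : ℂ) :=
    Complex.measurableEquivRealProd.symm.measurable
  have h := (hind.indepFun_prodMk_prodMk (fun _ => by fun_prop) 0 1 2 3 (by decide) (by decide)
    (by decide) (by decide)).comp hm hm
  exact (h.map_prod_eq_prod_map_map (hm.comp (by fun_prop)).aemeasurable
    (hm.comp (by fun_prop)).aemeasurable).trans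
    (congrArg₂ Measure.prod (pi_gaussianReal_map_complex (by decide))
      (pi_gaussianReal_map_complex (by decide)))

/-- The radial step of the modified pCN proposal preserves the Rayleigh(1) distribution:
with `(x₁, x₂, w₁, w₂)` four independent standard Gaussians and `0 ≤ k ≤ 1`, the random
variable `((1 - k²)·(x₁² + x₂²) + 2k·√(1 - k²)·√(x₁² + x₂²)·w₁ + k²·(w₁² + w₂²))^(1/2)`
has the same distribution as `√(x₁² + x₂²)`. -/
theorem pcn_radial_step (k : ℝ) (hk0 : 0 ≤ k) (hk1 : k ≤ 1) :
    Measure.map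
        (fun p : Fin 4 → ℝ =>
          Real.sqrt ((1 - k ^ 2) * (p 0 ^ 2 + p 1 ^ 2)
            + 2 * k * Real.sqrt (1 - k ^ 2) * Real.sqrt (p 0 ^ 2 + p 1 ^ 2) * p 2
            + k ^ 2 * (p 2 ^ 2 + p 3 ^ 2)))
        (Measure.pi fun _ : Fin 4 => gaussianReal 0 1)
      = Measure.map (fun p : Fin 4 → ℝ => Real.sqrt (p 0 ^ 2 + p 1 ^ 2))
          (Measure.pi fun _ : Fin 4 => gaussianReal 0 1) := by
  have hs : Real.sqrt (1 - k ^ 2) ^ 2 = 1 - k ^ 2 := Real.sq_sqrt (by nlinarith)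
  have hm (i j : Fin 4) : Measurable fun p : Fin 4 → ℝ => (⟨p i, p j⟩ : ℂ) :=
    Complex.measurableEquivRealProd.symm.measurable.comp
      (by fun_prop : Measurable fun p : Fin 4 → ℝ => (p i, p j))
  have hnorm (x y : ℝ) : ‖(⟨x, y⟩ : ℂ)‖ = Real.sqrt (x ^ 2 + y ^ 2) := by
    rw [Complex.norm_def, Complex.normSq_mk, sq, sq]
  have key := map_norm_smul_norm_add_smul (a := Real.sqrt (1 - k ^ 2)) (b := k)
    (by rw [hs]; ring)
  rw [← pi_gaussianReal_map_complex_prod,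
    ← pi_gaussianReal_map_complex (show (0 : Fin 4) ≠ 1 by decide),
    Measure.map_map (by fun_prop) ((hm 0 1).prodMk (hm 2 3)),
    Measure.map_map (by fun_prop) (hm 0 1)] at key
  convert key using 2
  · ext p
    have hr : Real.sqrt (p 0 ^ 2 + p 1 ^ 2) ^ 2 = p 0 ^ 2 + p 1 ^ 2 := Real.sq_sqrt (by positivity)
    simp only [Function.comp_apply, hnorm]
    congr 1
    simp only [Complex.add_re, Complex.add_im, Complex.re_ofReal_mul, Complex.im_ofReal_mul,
      Complex.ofReal_re, Complex.ofReal_im]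
    linear_combination (-Real.sqrt (p 0 ^ 2 + p 1 ^ 2) ^ 2) * hs - (1 - k ^ 2) * hr
  · ext p
    exact (hnorm _ _).symm
end
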